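/- Let M(W1, W2) = W1·W2 be the matrix multiplication mapping with W1 ∈ ℝ^{m×k}, W2 ∈ ℝ^{k×n}, and assume k < min(m, n). Then M is locally open at a point (W̄1, W̄2) relative to its range R_M if and only if the following two conditions both hold: (i) there exists W̃1 ∈ ℝ^{m×k} with W̃1·W̄2 = 0 such that W̄1 + W̃1 has full column rank, and (ii) there exists W̃2 ∈ ℝ^{k×n} with W̄1·W̃2 = 0 such that W̄2 + W̃2 has full row rank. -/

import Mathlib

open Matrix

/-- Frobenius norm of a real matrix. -/
noncomputable def frob {m n : ℕ} (A : Matrix (Fin m) (Fin n) ℝ) : ℝ :=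
  Real.sqrt (∑ i, ∑ j, (A i j) ^ 2)

/-- Local openness of the matrix multiplication mapping `M(W1, W2) = W1 * W2` at `(W1, W2)`
relative to its range `R_M = {Z : rank Z ≤ min (m, n, k)}`, with respect to the Frobenius
norm (and the corresponding product metric on pairs). -/
def MulLocOpenAt {m k n : ℕ} (W1 : Matrix (Fin m) (Fin k) ℝ)
    (W2 : Matrix (Fin k) (Fin n) ℝ) : Prop :=
  ∀ ε > 0, ∃ δ > 0, ∀ Z : Matrix (Fin m) (Fin n) ℝ,
    Z.rank ≤ min m (min n k) → frob (Z - W1 * W2) < δ →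
      ∃ (V1 : Matrix (Fin m) (Fin k) ℝ) (V2 : Matrix (Fin k) (Fin n) ℝ),
        frob (V1 - W1) < ε ∧ frob (V2 - W2) < ε ∧ V1 * V2 = Z

open Filter Topology

section LinearAlgebra

variable {K V W : Type*} [Field K] [AddCommGroup V] [Module K V] [AddCommGroup W] [Module K W]

theorem LinearMap.exists_comp_comp_self (f : V →ₗ[K] W) : ∃ g : W →ₗ[K] V, f ∘ₗ g ∘ₗ f = f := by
  obtain ⟨h, hh⟩ := f.rangeRestrict.exists_rightInverse_of_surjective f.range_rangeRestrict
  obtain ⟨g, hg⟩ := h.exists_extend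
  refine ⟨g, LinearMap.ext fun x => ?_⟩
  have h1 : g (f x) = h (f.rangeRestrict x) := LinearMap.congr_fun hg (f.rangeRestrict x)
  have h2 : f.rangeRestrict (h (f.rangeRestrict x)) = f.rangeRestrict x :=
    LinearMap.congr_fun hh (f.rangeRestrict x)
  simpa [h1] using congrArg Subtype.val h2

theorem LinearMap.exists_injective_eqOn [FiniteDimensional K V] [FiniteDimensional K W]
    (hVW : Module.finrank K V ≤ Module.finrank K W) (f : V →ₗ[K] W) (S : Submodule K V)
    (hf : ∀ x ∈ S, f x = 0 → x = 0) :
    ∃ g : V →ₗ[K] W, Function.Injective g ∧ ∀ x ∈ S, g x = f x := by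
  obtain ⟨S', hS⟩ := S.exists_isCompl
  obtain ⟨T, hT⟩ := (S.map f).exists_isCompl
  have hmap : Module.finrank K (S.map f) ≤ Module.finrank K S := Submodule.finrank_map_le f S
  have h1 := Submodule.finrank_add_eq_of_isCompl hS
  have h2 := Submodule.finrank_add_eq_of_isCompl hT
  obtain ⟨h, hh⟩ : ∃ h : S' →ₗ[K] T, Function.Injective h :=
    finrank_le_iff_exists_linearMap.mp (by omega)
  have key (u : S) : LinearMap.ofIsCompl hS (f ∘ₗ S.subtype) (T.subtype ∘ₗ h) u = f u :=
    LinearMap.ofIsCompl_apply_left hS u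
  have key' (v : S') : LinearMap.ofIsCompl hS (f ∘ₗ S.subtype) (T.subtype ∘ₗ h) v = h v :=
    LinearMap.ofIsCompl_apply_right hS v
  refine ⟨LinearMap.ofIsCompl hS (f ∘ₗ S.subtype) (T.subtype ∘ₗ h), ?_, fun x hx => key ⟨x, hx⟩⟩
  refine (injective_iff_map_eq_zero _).mpr fun x hx => ?_
  obtain ⟨a, ha, b, hb, rfl⟩ := Submodule.mem_sup.mp (hS.sup_eq_top ▸ Submodule.mem_top (x := x))
  rw [map_add, key ⟨a, ha⟩, key' ⟨b, hb⟩] at hx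
  have hfa : f a ∈ T := by
    rw [eq_neg_of_add_eq_zero_left hx]
    exact T.neg_mem (h _).2
  have hfa0 : f a = 0 :=
    (Submodule.disjoint_def.mp hT.disjoint) _ (Submodule.mem_map_of_mem ha) hfa
  have hb0 : (⟨b, hb⟩ : S') = 0 := by
    apply hh
    apply Subtype.ext
    simpa [hfa0] using hx
  have hb0' : b = 0 := congrArg Subtype.val hb0
  rw [hf a ha hfa0, hb0', add_zero]

end LinearAlgebra

namespace Matrix

section Field

variable {K : Type*} [Field K]

theorem exists_mul_mul_self {m n : ℕ} (A : Matrix (Fin m) (Fin n) K) :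
    ∃ G : Matrix (Fin n) (Fin m) K, A * G * A = A := by
  obtain ⟨g, hg⟩ := (toLin' A).exists_comp_comp_self
  refine ⟨LinearMap.toMatrix' g, toLin'.injective ?_⟩
  rw [toLin'_mul, toLin'_mul, toLin'_toMatrix']
  exact hg

theorem exists_left_inverse_of_injective {m k : ℕ} {U : Matrix (Fin m) (Fin k) K}
    (hU : Function.Injective (toLin' U)) : ∃ L : Matrix (Fin k) (Fin m) K, L * U = 1 := by
  obtain ⟨g, hg⟩ := (toLin' U).exists_leftInverse_of_injective (LinearMap.ker_eq_bot.mpr hU)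
  refine ⟨LinearMap.toMatrix' g, toLin'.injective ?_⟩
  rw [toLin'_mul, toLin'_toMatrix', hg, toLin'_one]

theorem exists_left_inverse_of_rank_eq {m k : ℕ} {U : Matrix (Fin m) (Fin k) K}
    (hU : U.rank = k) : ∃ L : Matrix (Fin k) (Fin m) K, L * U = 1 := by
  refine exists_left_inverse_of_injective (LinearMap.ker_eq_bot.mp ?_)
  have h1 := LinearMap.finrank_range_add_finrank_ker (toLin' U)
  have h2 : Module.finrank K (LinearMap.range (toLin' U)) = k := hU
  rw [h2, Module.finrank_fin_fun] at h1
  exact Submodule.finrank_eq_zero.mp (by omega)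

theorem exists_right_inverse_of_rank_eq {k n : ℕ} {U : Matrix (Fin k) (Fin n) K}
    (hU : U.rank = k) : ∃ R : Matrix (Fin n) (Fin k) K, U * R = 1 := by
  obtain ⟨L, hL⟩ := exists_left_inverse_of_rank_eq (U := Uᵀ) (by rw [rank_transpose, hU])
  exact ⟨Lᵀ, by rw [← transpose_inj]; simpa using hL⟩

theorem exists_rank_add_eq {m k n : ℕ} (hkm : k ≤ m) (A : Matrix (Fin m) (Fin k) K)
    (B : Matrix (Fin k) (Fin n) K) (h : ∀ u, A *ᵥ (B *ᵥ u) = 0 → B *ᵥ u = 0) :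
    ∃ A' : Matrix (Fin m) (Fin k) K, A' * B = 0 ∧ (A + A').rank = k := by
  obtain ⟨g, hg, hgA⟩ := (toLin' A).exists_injective_eqOn (by simpa using hkm)
    (LinearMap.range (toLin' B)) (by rintro _ ⟨u, rfl⟩; exact h u)
  refine ⟨LinearMap.toMatrix' g - A, ?_, ?_⟩
  · apply toLin'.injective
    rw [toLin'_mul, map_sub, toLin'_toMatrix']
    refine LinearMap.ext fun x => ?_
    simpa [sub_eq_zero] using hgA _ ⟨_, rfl⟩
  · have h1 := LinearMap.finrank_range_of_inj hg
    rw [Module.finrank_fin_fun] at h1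
    rw [add_sub_cancel, rank, ← toLin'_apply', toLin'_toMatrix', h1]

/-- A kernel basis of an idempotent `p`, together with its dual coordinates vanishing on the
range of `p`. -/
theorem exists_factor_compl_of_mul_self {k : ℕ} {p : Matrix (Fin k) (Fin k) K} (hp : p * p = p) :
    ∃ (e : ℕ) (f : Matrix (Fin e) (Fin k) K) (g : Matrix (Fin k) (Fin e) K),
      e + p.rank = k ∧ f * p = 0 ∧ p * g = 0 ∧ f * g = 1 := by
  let N := LinearMap.ker (toLin' p)
  let b := Module.finBasis K N
  have hq (x : Fin k → K) : (toLin' (1 - p)) x ∈ N := by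
    rw [LinearMap.mem_ker, ← LinearMap.comp_apply, ← toLin'_mul]
    simp [mul_sub, hp]
  let g : (Fin (Module.finrank K N) → K) →ₗ[K] (Fin k → K) :=
    N.subtype ∘ₗ b.equivFun.symm.toLinearMap
  let f : (Fin k → K) →ₗ[K] (Fin (Module.finrank K N) → K) :=
    b.equivFun.toLinearMap ∘ₗ (toLin' (1 - p)).codRestrict N hq
  refine ⟨Module.finrank K N, LinearMap.toMatrix' f, LinearMap.toMatrix' g, ?_, ?_, ?_, ?_⟩
  · have h1 := LinearMap.finrank_range_add_finrank_ker (toLin' p)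
    rw [Module.finrank_fin_fun] at h1
    rw [add_comm]
    exact h1
  · apply toLin'.injective
    rw [toLin'_mul, toLin'_toMatrix']
    refine LinearMap.ext fun x => ?_
    have : (toLin' (1 - p)).codRestrict N hq (toLin' p x) = 0 := by
      apply Subtype.ext
      simp [hp]
    rw [LinearMap.comp_apply, LinearMap.comp_apply, this, map_zero, map_zero,
      LinearMap.zero_apply]
  · apply toLin'.injective
    rw [toLin'_mul, toLin'_toMatrix']
    refine LinearMap.ext fun x => ?_
    rw [map_zero]
    exact (b.equivFun.symm x).2
  · apply toLin'.injective
    rw [toLin'_mul, toLin'_toMatrix', toLin'_toMatrix']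
    refine LinearMap.ext fun x => ?_
    have : (toLin' (1 - p)).codRestrict N hq (g x) = b.equivFun.symm x := by
      apply Subtype.ext
      have h0 : toLin' p (b.equivFun.symm x : Fin k → K) = 0 := (b.equivFun.symm x).2
      simp only [LinearMap.codRestrict_apply, map_sub, LinearMap.sub_apply, toLin'_one]
      simp only [g, LinearMap.comp_apply, Submodule.subtype_apply, LinearEquiv.coe_coe, h0]
      simp
    rw [LinearMap.comp_apply, LinearMap.comp_apply, this, toLin'_one]
    exact b.equivFun.apply_symm_apply x

theorem rank_add_rank_le_of_mul_eq_zero {m n k l r : ℕ} {Z : Matrix (Fin m) (Fin n) K}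
    (L : Matrix (Fin k) (Fin m) K) (X : Matrix (Fin n) (Fin l) K) (Y : Matrix (Fin n) (Fin r) K)
    (h : L * (Z * X) = 0) : (Z * X).rank + (L * Z * Y).rank ≤ Z.rank := by
  have key := LinearMap.finrank_range_add_finrank_ker
    ((toLin' L) ∘ₗ (LinearMap.range (toLin' Z)).subtype)
  have h1 : (L * Z * Y).rank ≤ Module.finrank K (LinearMap.range
      ((toLin' L) ∘ₗ (LinearMap.range (toLin' Z)).subtype)) := by
    apply Submodule.finrank_mono
    rintro _ ⟨y, rfl⟩
    exact ⟨⟨toLin' Z (Y *ᵥ y), ⟨_, rfl⟩⟩, by simp⟩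
  have h2 : (Z * X).rank ≤ Module.finrank K (LinearMap.ker
      ((toLin' L) ∘ₗ (LinearMap.range (toLin' Z)).subtype)) := by
    rw [← LinearMap.finrank_range_of_inj (f := (LinearMap.range (toLin' Z)).subtype ∘ₗ
      (LinearMap.ker ((toLin' L) ∘ₗ (LinearMap.range (toLin' Z)).subtype)).subtype)
      (Subtype.val_injective.comp Subtype.val_injective)]
    apply Submodule.finrank_mono
    rintro _ ⟨x, rfl⟩
    refine ⟨⟨⟨toLin' Z (X *ᵥ x), ⟨_, rfl⟩⟩, ?_⟩, by simp⟩
    simp [h]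
  have h3 : Z.rank = Module.finrank K (LinearMap.range (toLin' Z)) := rfl
  omega

theorem exists_mul_eq_one_of_le {m k : ℕ} (h : k ≤ m) :
    ∃ (L : Matrix (Fin k) (Fin m) K) (A : Matrix (Fin m) (Fin k) K), L * A = 1 := by
  obtain ⟨f, hf⟩ : ∃ f : (Fin k → K) →ₗ[K] (Fin m → K), Function.Injective f :=
    finrank_le_iff_exists_linearMap.mp (by simpa using h)
  obtain ⟨L, hL⟩ := exists_left_inverse_of_injective (U := LinearMap.toMatrix' f)
    (by rwa [toLin'_toMatrix'])
  exact ⟨L, _, hL⟩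

theorem exists_mul_eq_one_of_lt {k n : ℕ} (h : k < n) (u : Fin n → K) :
    ∃ (B : Matrix (Fin k) (Fin n) K) (R : Matrix (Fin n) (Fin k) K), B * R = 1 ∧ B *ᵥ u = 0 := by
  have h1 := (K ∙ u).finrank_quotient_add_finrank
  have h2 : Module.finrank K (K ∙ u) ≤ 1 := (finrank_span_le_card _).trans (by simp)
  rw [Module.finrank_fin_fun] at h1
  obtain ⟨f, hf⟩ : ∃ f : (Fin k → K) →ₗ[K] ((Fin n → K) ⧸ (K ∙ u)), Function.Injective f :=
    finrank_le_iff_exists_linearMap.mp (by rw [Module.finrank_fin_fun]; omega)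
  obtain ⟨g, hg⟩ := f.exists_leftInverse_of_injective (LinearMap.ker_eq_bot.mpr hf)
  have hs : Function.Surjective (g ∘ₗ (K ∙ u).mkQ) :=
    Function.Surjective.comp (g := g) (fun x => ⟨f x, LinearMap.congr_fun hg x⟩)
      (K ∙ u).mkQ_surjective
  obtain ⟨r, hr⟩ := (g ∘ₗ (K ∙ u).mkQ).exists_rightInverse_of_surjective
    (LinearMap.range_eq_top.mpr hs)
  refine ⟨LinearMap.toMatrix' (g ∘ₗ (K ∙ u).mkQ), LinearMap.toMatrix' r, ?_, ?_⟩
  · rw [← LinearMap.toMatrix'_comp, hr, LinearMap.toMatrix'_id]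
  · have h0 : (K ∙ u).mkQ u = 0 := by simp [Submodule.mem_span_singleton_self]
    rw [LinearMap.toMatrix'_mulVec, LinearMap.comp_apply, h0, map_zero]

end Field

theorem eventually_isUnit_add_smul_one {k : ℕ} (A : Matrix (Fin k) (Fin k) ℝ) :
    ∀ᶠ t : ℝ in 𝓝[≠] 0, IsUnit (A + t • (1 : Matrix (Fin k) (Fin k) ℝ)) := by
  have h : ∀ᶠ t : ℝ in cofinite, t ∉ spectrum ℝ (-A) :=
    (Matrix.finite_spectrum (-A)).compl_mem_cofinite
  filter_upwards [nhdsNE_le_cofinite 0 h] with t ht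
  rw [spectrum.notMem_iff, Algebra.algebraMap_eq_smul_one, sub_neg_eq_add, add_comm] at ht
  exact ht

end Matrix

theorem frob_transpose {m n : ℕ} (A : Matrix (Fin m) (Fin n) ℝ) : frob Aᵀ = frob A := by
  simp only [frob, transpose_apply]
  rw [Finset.sum_comm]

theorem continuous_frob {m n : ℕ} :
    Continuous (frob : Matrix (Fin m) (Fin n) ℝ → ℝ) := by
  unfold frob
  fun_prop

theorem abs_apply_le_frob {m n : ℕ} (A : Matrix (Fin m) (Fin n) ℝ) (i : Fin m) (j : Fin n) :
    |A i j| ≤ frob A := by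
  refine Real.abs_le_sqrt ?_
  calc A i j ^ 2 ≤ ∑ j, A i j ^ 2 :=
        Finset.single_le_sum (f := fun j => A i j ^ 2) (fun _ _ => sq_nonneg _) (Finset.mem_univ j)
    _ ≤ ∑ i, ∑ j, A i j ^ 2 :=
        Finset.single_le_sum (f := fun i => ∑ j, A i j ^ 2)
          (fun _ _ => Finset.sum_nonneg fun _ _ => sq_nonneg _) (Finset.mem_univ i)

theorem Matrix.mem_nhds_iff_exists_abs_lt {m n : ℕ} {W : Matrix (Fin m) (Fin n) ℝ}
    {s : Set (Matrix (Fin m) (Fin n) ℝ)} :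
    s ∈ 𝓝 W ↔ ∃ ε > 0, ∀ V, (∀ i j, |V i j - W i j| < ε) → V ∈ s := by
  let _ := Matrix.normedAddCommGroup (m := Fin m) (n := Fin n) (α := ℝ)
  change s ∈ @nhds _ (PseudoMetricSpace.toUniformSpace.toTopologicalSpace) W ↔ _
  rw [Metric.mem_nhds_iff]
  refine exists_congr fun ε => and_congr_right fun hε => forall_congr' fun V => ?_
  rw [Metric.mem_ball, dist_eq_norm, Matrix.norm_lt_iff hε]
  rfl

theorem mem_nhds_iff_frob {m n : ℕ} {W : Matrix (Fin m) (Fin n) ℝ}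
    {s : Set (Matrix (Fin m) (Fin n) ℝ)} :
    s ∈ 𝓝 W ↔ ∃ ε > 0, ∀ V, frob (V - W) < ε → V ∈ s := by
  constructor
  · rw [Matrix.mem_nhds_iff_exists_abs_lt]
    rintro ⟨ε, hε, h⟩
    exact ⟨ε, hε, fun V hV => h V fun i j => (abs_apply_le_frob (V - W) i j).trans_lt hV⟩
  · rintro ⟨ε, hε, h⟩
    have hc : Continuous fun V : Matrix (Fin m) (Fin n) ℝ => frob (V - W) :=
      continuous_frob.comp (continuous_id.sub continuous_const)
    have h0 : frob (W - W) < ε := by simpa [frob] using hε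
    exact mem_of_superset (hc.continuousAt.preimage_mem_nhds (Iio_mem_nhds h0)) fun V hV => h V hV

theorem mulLocOpenAt_iff {m k n : ℕ} {W1 : Matrix (Fin m) (Fin k) ℝ}
    {W2 : Matrix (Fin k) (Fin n) ℝ} :
    MulLocOpenAt W1 W2 ↔ ∀ s ∈ 𝓝 W1, ∀ t ∈ 𝓝 W2, ∀ᶠ Z in 𝓝 (W1 * W2),
      Z.rank ≤ min m (min n k) → ∃ V1 ∈ s, ∃ V2 ∈ t, V1 * V2 = Z := by
  constructor
  · intro h s hs t ht
    obtain ⟨ε₁, hε₁, h₁⟩ := mem_nhds_iff_frob.mp hs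
    obtain ⟨ε₂, hε₂, h₂⟩ := mem_nhds_iff_frob.mp ht
    obtain ⟨δ, hδ, hZ⟩ := h (min ε₁ ε₂) (lt_min hε₁ hε₂)
    refine mem_nhds_iff_frob.mpr ⟨δ, hδ, fun Z hZδ hr => ?_⟩
    obtain ⟨V1, V2, hV1, hV2, hV⟩ := hZ Z hr hZδ
    exact ⟨V1, h₁ _ (hV1.trans_le (min_le_left _ _)), V2, h₂ _ (hV2.trans_le (min_le_right _ _)), hV⟩
  · intro h ε hε
    obtain ⟨δ, hδ, hZ⟩ := mem_nhds_iff_frob.mp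
      (h {V | frob (V - W1) < ε} (mem_nhds_iff_frob.mpr ⟨ε, hε, fun _ hV => hV⟩)
        {V | frob (V - W2) < ε} (mem_nhds_iff_frob.mpr ⟨ε, hε, fun _ hV => hV⟩))
    refine ⟨δ, hδ, fun Z hr hZδ => ?_⟩
    obtain ⟨V1, hV1, V2, hV2, hV⟩ := hZ Z hZδ hr
    exact ⟨V1, V2, hV1, hV2, hV⟩

theorem MulLocOpenAt.transpose {m k n : ℕ} {W1 : Matrix (Fin m) (Fin k) ℝ}
    {W2 : Matrix (Fin k) (Fin n) ℝ} (h : MulLocOpenAt W1 W2) : MulLocOpenAt W2ᵀ W1ᵀ := by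
  intro ε hε
  obtain ⟨δ, hδ, hZ⟩ := h ε hε
  refine ⟨δ, hδ, fun Z hr hZδ => ?_⟩
  obtain ⟨V1, V2, hV1, hV2, hV⟩ := hZ Zᵀ (by rw [rank_transpose]; omega)
    (by rw [← frob_transpose]; simpa using hZδ)
  refine ⟨V2ᵀ, V1ᵀ, ?_, ?_, ?_⟩
  · rwa [← transpose_sub, frob_transpose]
  · rwa [← transpose_sub, frob_transpose]
  · rw [← transpose_mul, hV, transpose_transpose]

theorem MulLocOpenAt.mulVec_eq_zero {m k n : ℕ} (hkm : k ≤ m) (hkn : k < n)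
    {W1 : Matrix (Fin m) (Fin k) ℝ} {W2 : Matrix (Fin k) (Fin n) ℝ} (h : MulLocOpenAt W1 W2)
    {u : Fin n → ℝ} (hu : W1 *ᵥ (W2 *ᵥ u) = 0) : W2 *ᵥ u = 0 := by
  by_contra hne
  obtain ⟨G, hG⟩ := W1.exists_mul_mul_self
  obtain ⟨L, A, hLA⟩ := exists_mul_eq_one_of_le (K := ℝ) hkm
  obtain ⟨B, R, hBR, hBu⟩ := exists_mul_eq_one_of_lt hkn u
  let Z : ℝ → Matrix (Fin m) (Fin n) ℝ := fun t => (W1 + t • A) * (G * W1 * W2 + t • B)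
  have hZ : Tendsto Z (𝓝[≠] 0) (𝓝 (W1 * W2)) := by
    have hc : Continuous Z := by fun_prop
    have h0 : Z 0 = W1 * W2 := by simp [Z, ← Matrix.mul_assoc, hG]
    rw [← h0]
    exact hc.continuousAt.mono_left nhdsWithin_le_nhds
  have ht : {V : Matrix (Fin k) (Fin n) ℝ | V *ᵥ u ≠ 0} ∈ 𝓝 W2 :=
    (isOpen_ne_fun (by fun_prop) continuous_const).mem_nhds hne
  obtain ⟨t, hV, h1, h2⟩ := ((hZ.eventually (mulLocOpenAt_iff.mp h _ univ_mem _ ht)).and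
    ((eventually_isUnit_add_smul_one (L * W1)).and
      (eventually_isUnit_add_smul_one (G * W1 * W2 * R)))).exists
  obtain ⟨V1, -, V2, hV2, hVZ⟩ := hV (by
    have h3 : (Z t).rank ≤ k := (rank_mul_le_left _ _).trans (rank_le_width _)
    omega)
  have hprod : (L * V1) * (V2 * R) = (L * W1 + t • 1) * (G * W1 * W2 * R + t • 1) := by
    calc (L * V1) * (V2 * R) = L * (V1 * V2) * R := by simp only [Matrix.mul_assoc]
      _ = (L * (W1 + t • A)) * ((G * W1 * W2 + t • B) * R) := by
        rw [hVZ]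
        simp only [Z, Matrix.mul_assoc]
      _ = _ := by
        rw [Matrix.mul_add, Matrix.add_mul _ _ R, Matrix.mul_smul, Matrix.smul_mul, hLA, hBR]
  have hunit : IsUnit (L * V1) := by
    have hd := (isUnit_iff_isUnit_det _).mp (hprod ▸ h1.mul h2)
    rw [det_mul] at hd
    exact (isUnit_iff_isUnit_det _).mpr (isUnit_of_mul_isUnit_left hd)
  apply hV2
  apply mulVec_injective_iff_isUnit.mpr hunit
  have hZu : Z t *ᵥ u = 0 := by
    have h4 : (G * W1 * W2) *ᵥ u = 0 := by
      rw [← mulVec_mulVec, ← mulVec_mulVec, hu, mulVec_zero]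
    simp only [Z]
    rw [← mulVec_mulVec, add_mulVec (G * W1 * W2), smul_mulVec, h4, hBu]
    simp
  rw [mulVec_mulVec, Matrix.mul_assoc, hVZ, ← mulVec_mulVec, hZu, mulVec_zero, mulVec_zero]

namespace Matrix

theorem abs_mul_apply_le {m k n : ℕ} {A : Matrix (Fin m) (Fin k) ℝ} {B : Matrix (Fin k) (Fin n) ℝ}
    {a b : ℝ} (hA : ∀ i j, |A i j| ≤ a) (hB : ∀ i j, |B i j| ≤ b) (i : Fin m) (j : Fin n) :
    |(A * B) i j| ≤ k * (a * b) := by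
  rw [mul_apply]
  calc |∑ l, A i l * B l j| ≤ ∑ l : Fin k, |A i l * B l j| := Finset.abs_sum_le_sum_abs _ _
    _ ≤ ∑ _l : Fin k, a * b := Finset.sum_le_sum fun l _ => by
        rw [abs_mul]
        exact mul_le_mul (hA i l) (hB l j) (abs_nonneg _) ((abs_nonneg _).trans (hA i l))
    _ = k * (a * b) := by simp

theorem exists_mul_transpose_mul_eq_self {m n : ℕ} (S : Matrix (Fin m) (Fin n) ℝ) :
    ∃ Q : Matrix (Fin m) (Fin S.rank) ℝ, (∀ i j, |Q i j| ≤ 1) ∧ Q * (Qᵀ * S) = S := by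
  let φ := (WithLp.linearEquiv 2 ℝ (Fin m → ℝ)).symm
  let N : Submodule ℝ (EuclideanSpace ℝ (Fin m)) :=
    (LinearMap.range (toLin' S)).map φ.toLinearMap
  have hN : Module.finrank ℝ N = S.rank := LinearEquiv.finrank_map_eq φ _
  let b : OrthonormalBasis (Fin S.rank) ℝ N := (stdOrthonormalBasis ℝ N).reindex (finCongr hN)
  refine ⟨of fun i j => (b j : EuclideanSpace ℝ (Fin m)) i, fun i j => ?_, ?_⟩
  · have h1 : ‖(b j : EuclideanSpace ℝ (Fin m))‖ = 1 := b.orthonormal.1 j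
    rw [← h1]
    exact PiLp.norm_apply_le (b j : EuclideanSpace ℝ (Fin m)) i
  · ext i l
    have hx : φ (S.col l) ∈ N :=
      Submodule.mem_map_of_mem ⟨Pi.single l 1, by simp⟩
    have h := congrArg (fun y : N => (y : EuclideanSpace ℝ (Fin m)) i) (b.sum_repr' ⟨_, hx⟩)
    have hS : (φ (S.col l)) i = S i l := rfl
    simp only [hS] at h
    rw [← h, mul_apply]
    simp only [Submodule.coe_sum, Submodule.coe_smul, WithLp.ofLp_sum, Finset.sum_apply,
      WithLp.ofLp_smul, Pi.smul_apply, smul_eq_mul, Submodule.coe_inner]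
    refine Finset.sum_congr rfl fun j _ => ?_
    rw [mul_comm, of_apply, mul_apply, PiLp.inner_apply]
    congr 1
    refine Finset.sum_congr rfl fun r _ => ?_
    simp [φ, mul_comm]

theorem exists_mul_transpose_mul_eq_self_of_rank_le {m n e : ℕ} {S : Matrix (Fin m) (Fin n) ℝ}
    (hS : S.rank ≤ e) :
    ∃ Q : Matrix (Fin m) (Fin e) ℝ, (∀ i j, |Q i j| ≤ e) ∧ Q * (Qᵀ * S) = S := by
  obtain ⟨Q, hQ, hQS⟩ := S.exists_mul_transpose_mul_eq_self
  let J : Matrix (Fin S.rank) (Fin e) ℝ := (1 : Matrix (Fin e) (Fin e) ℝ).submatrix (Fin.castLE hS) id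
  have hJ : J * Jᵀ = 1 := by
    rw [transpose_submatrix, transpose_one, ← submatrix_mul _ _ _ id _ Function.bijective_id,
      Matrix.mul_one, submatrix_one _ (Fin.castLE_injective hS)]
  have hJ1 (i j) : |J i j| ≤ 1 := by
    simp only [J, submatrix_apply, one_apply]
    split_ifs <;> simp
  refine ⟨Q * J, fun i j => (abs_mul_apply_le hQ hJ1 i j).trans (by simpa using hS), ?_⟩
  calc Q * J * ((Q * J)ᵀ * S) = Q * (J * Jᵀ) * (Qᵀ * S) := by
        simp only [transpose_mul, Matrix.mul_assoc]
    _ = S := by rw [hJ, Matrix.mul_one, hQS]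

theorem eventually_exists_mul_eq_of_rank_le {m n e : ℕ} {s : Set (Matrix (Fin m) (Fin e) ℝ)}
    {t : Set (Matrix (Fin e) (Fin n) ℝ)} (hs : s ∈ 𝓝 0) (ht : t ∈ 𝓝 0) :
    ∀ᶠ S : Matrix (Fin m) (Fin n) ℝ in 𝓝 0, S.rank ≤ e → ∃ T1 ∈ s, ∃ T2 ∈ t, T1 * T2 = S := by
  obtain ⟨ε₁, hε₁, h₁⟩ := mem_nhds_iff_exists_abs_lt.mp hs
  obtain ⟨ε₂, hε₂, h₂⟩ := mem_nhds_iff_exists_abs_lt.mp ht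
  obtain ⟨η, hη, hη₁⟩ : ∃ η > 0, η * e < ε₁ :=
    ⟨ε₁ / (e + 1), by positivity, by
      rw [div_mul_eq_mul_div, div_lt_iff₀ (by positivity)]
      nlinarith⟩
  refine mem_nhds_iff_exists_abs_lt.mpr ⟨η * ε₂ / (m * e + 1), by positivity, fun S hS hr => ?_⟩
  obtain ⟨Q, hQ, hQS⟩ := exists_mul_transpose_mul_eq_self_of_rank_le hr
  refine ⟨η • Q, h₁ _ fun i j => ?_, η⁻¹ • (Qᵀ * S), h₂ _ fun i j => ?_, ?_⟩
  · rw [zero_apply, sub_zero, smul_apply, smul_eq_mul, abs_mul, abs_of_pos hη]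
    exact (mul_le_mul_of_nonneg_left (hQ i j) hη.le).trans_lt hη₁
  · have h3 := abs_mul_apply_le (A := Qᵀ) (B := S) (fun i j => hQ j i)
      (fun i j => by simpa using (hS i j).le) i j
    rw [zero_apply, sub_zero, smul_apply, smul_eq_mul, abs_mul, abs_of_pos (inv_pos.mpr hη),
      inv_mul_lt_iff₀ hη]
    refine h3.trans_lt ?_
    rw [← mul_assoc, mul_div_assoc', div_lt_iff₀ (by positivity)]
    nlinarith [mul_pos hη hε₂]
  · rw [Matrix.smul_mul, Matrix.mul_smul, smul_smul, mul_inv_cancel₀ hη.ne', one_smul, hQS]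

end Matrix

theorem mulLocOpenAt_of_mul_eq {m k n : ℕ} {W1 : Matrix (Fin m) (Fin k) ℝ}
    {W2 : Matrix (Fin k) (Fin n) ℝ} {G : Matrix (Fin n) (Fin m) ℝ}
    (h1 : W1 * (W2 * G * W1) = W1) (h2 : W2 * G * W1 * W2 = W2) : MulLocOpenAt W1 W2 := by
  rw [mulLocOpenAt_iff]
  intro s hs t ht
  set p := W2 * G * W1 with hp
  set L := W2 * G with hL
  set R := G * W1 with hR
  have hpL : p * L = L := by rw [hL, ← Matrix.mul_assoc, h2]
  have hRp : R * p = R := by rw [hR, Matrix.mul_assoc, h1]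
  have hpp : p * p = p := by
    nth_rewrite 1 [hp]
    rw [Matrix.mul_assoc, h1]
  have hW2R : W2 * R = p := by rw [hR, ← Matrix.mul_assoc]
  clear_value p L R
  obtain ⟨e, f, g, he, hfp, hpg, hfg⟩ := exists_factor_compl_of_mul_self hpp
  let A : Matrix (Fin m) (Fin n) ℝ → Matrix (Fin k) (Fin k) ℝ := fun Z => L * Z * R + (1 - p)
  have hA : Continuous A := by fun_prop
  have hA0 : A (W1 * W2) = 1 := by
    have : L * (W1 * W2) * R = p := by
      rw [Matrix.mul_assoc L, Matrix.mul_assoc W1, hW2R, h1, hp]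
    simp [A, this]
  have hdet : ∀ᶠ Z in 𝓝 (W1 * W2), IsUnit (A Z).det := by
    have : {x : ℝ | x ≠ 0} ∈ 𝓝 (A (W1 * W2)).det := isOpen_ne.mem_nhds (by simp [hA0])
    filter_upwards [hA.matrix_det.continuousAt this] with Z hZ
    exact isUnit_iff_ne_zero.mpr hZ
  have hinv : Tendsto (fun Z => (A Z)⁻¹) (𝓝 (W1 * W2)) (𝓝 1) := by
    have h3 : ContinuousAt (Inv.inv : Matrix (Fin k) (Fin k) ℝ → _) (A (W1 * W2)) :=
      continuousAt_matrix_inv _ (by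
        rw [Ring.inverse_eq_inv', hA0, det_one]
        exact continuousAt_inv₀ one_ne_zero)
    have h4 := h3.comp hA.continuousAt
    simpa [ContinuousAt, hA0, Function.comp_def] using h4
  have hmul {a b c : ℕ} : Continuous fun q : Matrix (Fin a) (Fin b) ℝ × Matrix (Fin b) (Fin c) ℝ =>
      q.1 * q.2 := continuous_fst.matrix_mul continuous_snd
  have hZRA : Tendsto (fun Z => Z * R * (A Z)⁻¹) (𝓝 (W1 * W2)) (𝓝 W1) := by
    have h3 : Tendsto (fun Z => Z * R) (𝓝 (W1 * W2)) (𝓝 W1) := by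
      have h5 : Continuous fun Z : Matrix (Fin m) (Fin n) ℝ => Z * R := by fun_prop
      have h4 := h5.tendsto (W1 * W2)
      rwa [Matrix.mul_assoc, hW2R, h1] at h4
    have h4 := (hmul.tendsto (W1, (1 : Matrix (Fin k) (Fin k) ℝ))).comp (h3.prodMk_nhds hinv)
    simpa [Function.comp_def] using h4
  have hLZ : Tendsto (fun Z => L * Z) (𝓝 (W1 * W2)) (𝓝 W2) := by
    have h5 : Continuous fun Z : Matrix (Fin m) (Fin n) ℝ => L * Z := by fun_prop
    have h4 := h5.tendsto (W1 * W2)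
    rwa [← Matrix.mul_assoc, ← hp, h2] at h4
  have hS : Tendsto (fun Z => Z - Z * R * (A Z)⁻¹ * (L * Z)) (𝓝 (W1 * W2)) (𝓝 0) := by
    have h4 := (hmul.tendsto (W1, W2)).comp (hZRA.prodMk_nhds hLZ)
    have h5 := tendsto_id.sub h4
    simpa [Function.comp_def] using h5
  have hs' : ∀ᶠ q : Matrix (Fin m) (Fin k) ℝ × Matrix (Fin m) (Fin e) ℝ in 𝓝 (W1, 0),
      q.1 + q.2 * f ∈ s := by
    have h3 : Continuous fun q : Matrix (Fin m) (Fin k) ℝ × Matrix (Fin m) (Fin e) ℝ =>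
      q.1 + q.2 * f := by fun_prop
    exact h3.continuousAt.preimage_mem_nhds (by simpa using hs)
  have ht' : ∀ᶠ q : Matrix (Fin k) (Fin n) ℝ × Matrix (Fin e) (Fin n) ℝ in 𝓝 (W2, 0),
      q.1 + g * q.2 ∈ t := by
    have h3 : Continuous fun q : Matrix (Fin k) (Fin n) ℝ × Matrix (Fin e) (Fin n) ℝ =>
      q.1 + g * q.2 := by fun_prop
    exact h3.continuousAt.preimage_mem_nhds (by simpa using ht)
  rw [nhds_prod_eq] at hs' ht'
  obtain ⟨P1, hP1, D1, hD1, hPD1⟩ := eventually_prod_iff.mp hs'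
  obtain ⟨P2, hP2, D2, hD2, hPD2⟩ := eventually_prod_iff.mp ht'
  filter_upwards [hdet, hZRA.eventually hP1, hLZ.eventually hP2,
    hS.eventually (eventually_exists_mul_eq_of_rank_le hD1 hD2)] with Z hZ hZ1 hZ2 hZS hr
  have hApL : p * A Z = L * Z * R := by
    simp only [A, Matrix.mul_add, Matrix.mul_sub, Matrix.mul_one, hpp, sub_self, add_zero]
    rw [← Matrix.mul_assoc, ← Matrix.mul_assoc, hpL]
  have hLZRA : L * Z * (R * (A Z)⁻¹) = p := by
    rw [← Matrix.mul_assoc, ← hApL, Matrix.mul_assoc, mul_nonsing_inv _ hZ, Matrix.mul_one]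
  have hRg : R * g = 0 := by rw [← hRp, Matrix.mul_assoc, hpg, Matrix.mul_zero]
  have hfL : f * L = 0 := by rw [← hpL, ← Matrix.mul_assoc, hfp, Matrix.zero_mul]
  have hAg : (A Z)⁻¹ * g = g := by
    have h3 : A Z * g = g := by
      simp only [A, Matrix.add_mul, Matrix.sub_mul, Matrix.one_mul, hpg, Matrix.mul_assoc, hRg,
        Matrix.mul_zero, sub_zero, zero_add]
    nth_rewrite 1 [← h3]
    rw [← Matrix.mul_assoc, nonsing_inv_mul _ hZ, Matrix.one_mul]
  obtain ⟨T1, hT1, T2, hT2, hT⟩ := hZS (by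
    have hSX : Z - Z * R * (A Z)⁻¹ * (L * Z) = Z * (1 - R * (A Z)⁻¹ * (L * Z)) := by
      simp only [Matrix.mul_sub, Matrix.mul_one, Matrix.mul_assoc]
    have h3 := rank_add_rank_le_of_mul_eq_zero (Z := Z) L (1 - R * (A Z)⁻¹ * (L * Z))
      (R * (A Z)⁻¹) (by
        rw [← Matrix.mul_assoc, Matrix.mul_sub, Matrix.mul_one, ← Matrix.mul_assoc, hLZRA,
          ← Matrix.mul_assoc, hpL, sub_self])
    rw [hLZRA] at h3
    rw [hSX]
    omega)
  refine ⟨_, hPD1 hZ1 hT1, _, hPD2 hZ2 hT2, ?_⟩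
  have e1 : Z * R * (A Z)⁻¹ * (g * T2) = 0 := by
    rw [Matrix.mul_assoc (Z * R), ← Matrix.mul_assoc _ g, hAg, Matrix.mul_assoc,
      ← Matrix.mul_assoc R, hRg, Matrix.zero_mul, Matrix.mul_zero]
  have e2 : T1 * f * (L * Z) = 0 := by
    rw [Matrix.mul_assoc, ← Matrix.mul_assoc f, hfL, Matrix.zero_mul, Matrix.mul_zero]
  have e3 : T1 * f * (g * T2) = T1 * T2 := by
    rw [Matrix.mul_assoc, ← Matrix.mul_assoc f, hfg, Matrix.one_mul]
  rw [Matrix.add_mul, Matrix.mul_add, Matrix.mul_add, e1, e2, e3, hT]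
  simp

theorem mulLocOpenAt_of_rank_eq {m k n : ℕ} {W1 W1' : Matrix (Fin m) (Fin k) ℝ}
    {W2 W2' : Matrix (Fin k) (Fin n) ℝ} (h1 : W1' * W2 = 0) (hr1 : (W1 + W1').rank = k)
    (h2 : W1 * W2' = 0) (hr2 : (W2 + W2').rank = k) : MulLocOpenAt W1 W2 := by
  obtain ⟨G, hG⟩ := (W1 * W2).exists_mul_mul_self
  obtain ⟨L, hL⟩ := exists_left_inverse_of_rank_eq hr1
  obtain ⟨R, hR⟩ := exists_right_inverse_of_rank_eq hr2
  have hU1 : (W1 + W1') * W2 = W1 * W2 := by rw [Matrix.add_mul, h1, add_zero]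
  have hU2 : W1 * (W2 + W2') = W1 * W2 := by rw [Matrix.mul_add, h2, add_zero]
  have hLW : L * (W1 * W2) = W2 := by rw [← hU1, ← Matrix.mul_assoc, hL, Matrix.one_mul]
  have hWR : W1 * W2 * R = W1 := by rw [← hU2, Matrix.mul_assoc, hR, Matrix.mul_one]
  refine mulLocOpenAt_of_mul_eq (G := G) ?_ ?_
  · calc W1 * (W2 * G * W1) = W1 * W2 * G * W1 := by simp only [Matrix.mul_assoc]
      _ = W1 * W2 * G * (W1 * W2 * R) := by rw [hWR]
      _ = W1 * W2 * G * (W1 * W2) * R := by simp only [Matrix.mul_assoc]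
      _ = W1 := by rw [hG, hWR]
  · calc W2 * G * W1 * W2 = W2 * G * (W1 * W2) := by simp only [Matrix.mul_assoc]
      _ = L * (W1 * W2) * G * (W1 * W2) := by rw [hLW]
      _ = L * (W1 * W2 * G * (W1 * W2)) := by simp only [Matrix.mul_assoc]
      _ = W2 := by rw [hG, hLW]

theorem MulLocOpenAt.exists_rank_eq {m k n : ℕ} (hkm : k ≤ m) (hkn : k < n)
    {W1 : Matrix (Fin m) (Fin k) ℝ} {W2 : Matrix (Fin k) (Fin n) ℝ} (h : MulLocOpenAt W1 W2) :
    ∃ W1' : Matrix (Fin m) (Fin k) ℝ, W1' * W2 = 0 ∧ (W1 + W1').rank = k :=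
  exists_rank_add_eq hkm W1 W2 fun _ hu => h.mulVec_eq_zero hkm hkn hu

/-- For `k < min m n`, the multiplication mapping is locally open at
`(W1, W2)` relative to its range iff both: (i) some `W̃1` with `W̃1·W2 = 0` makes `W1 + W̃1`
full column rank, and (ii) some `W̃2` with `W1·W̃2 = 0` makes `W2 + W̃2` full row rank. -/
theorem statement_18 {m k n : ℕ} (hk : k < min m n)
    (W1 : Matrix (Fin m) (Fin k) ℝ) (W2 : Matrix (Fin k) (Fin n) ℝ) :
    MulLocOpenAt W1 W2 ↔
      ((∃ W1' : Matrix (Fin m) (Fin k) ℝ, W1' * W2 = 0 ∧ (W1 + W1').rank = k) ∧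
       (∃ W2' : Matrix (Fin k) (Fin n) ℝ, W1 * W2' = 0 ∧ (W2 + W2').rank = k)) := by
  obtain ⟨hkm, hkn⟩ := lt_min_iff.mp hk
  constructor
  · intro h
    refine ⟨h.exists_rank_eq hkm.le hkn, ?_⟩
    obtain ⟨X, hX, hr⟩ := h.transpose.exists_rank_eq hkn.le hkm
    refine ⟨Xᵀ, ?_, ?_⟩
    · rw [← transpose_inj]
      simpa using hX
    · rw [← rank_transpose]
      simpa using hr
  · rintro ⟨⟨W1', h1, hr1⟩, W2', h2, hr2⟩
    exact mulLocOpenAt_of_rank_eq h1 hr1 h2 hr2
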